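/- Let (ℙ^{s,η})_{(s,η)∈ℝ₊×Ω} be a path-dependent canonical class satisfying Hypothesis (H). Then for every (s,η) ∈ ℝ₊×Ω and every t ≥ s, the ℙ^{s,η}-closure of F^o_t coincides with the ℙ^{s,η}-closure of F_t; that is, for every B in the ℙ^{s,η}-closure of F_t there exists F^o ∈ F^o_t with 1_B = 1_{F^o} ℙ^{s,η}-almost surely, and conversely. -/

import Mathlib

open MeasureTheory Filter Topology Set
open scoped NNReal ENNReal

noncomputable section

/-- A function indexed by `ℝ≥0` is *cadlag* if it is right-continuous and has
left limits at every positive time. -/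
def IsCadlag {X : Type*} [TopologicalSpace X] (f : ℝ≥0 → X) : Prop :=
  (∀ t : ℝ≥0, Tendsto f (𝓝[Set.Ici t] t) (𝓝 (f t))) ∧
    ∀ t : ℝ≥0, 0 < t → ∃ l : X, Tendsto f (𝓝[Set.Iio t] t) (𝓝 l)

variable (E : Type*) [TopologicalSpace E] [MeasurableSpace E]

/-- The canonical path space `Ω = D(ℝ₊, E)` of cadlag paths with values in `E`. -/
def PathOmega := {f : ℝ≥0 → E // IsCadlag f}

/-- The canonical σ-field `𝓕 = σ(X_r ; r ≥ 0)` on the path space. -/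
instance instPathOmegaMS : MeasurableSpace (PathOmega E) :=
  ⨆ r : ℝ≥0, MeasurableSpace.comap (fun ω : PathOmega E => ω.1 r) inferInstance

/-- The initial filtration `𝓕^o_t = σ(X_r ; r ≤ t)`. -/
def Fot (t : ℝ≥0) : MeasurableSpace (PathOmega E) :=
  ⨆ r ∈ Set.Iic t, MeasurableSpace.comap (fun ω : PathOmega E => ω.1 r) inferInstance

/-- The canonical (right-continuous) filtration `𝓕_t = ⋂_{s > t} 𝓕^o_s`. -/
def Ft (t : ℝ≥0) : MeasurableSpace (PathOmega E) :=
  ⨅ u ∈ Set.Ioi t, Fot E u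

variable {E}

/-- A *path-dependent canonical class*. -/
structure IsPathCanonicalClass (P : ℝ≥0 → PathOmega E → Measure (PathOmega E)) : Prop where
  isProb : ∀ s η, IsProbabilityMeasure (P s η)
  starts : ∀ (s : ℝ≥0) (η : PathOmega E), P s η {ω | ∀ r ≤ s, ω.1 r = η.1 r} = 1
  fos_meas : ∀ (s : ℝ≥0) (F : Set (PathOmega E)), MeasurableSet F →
    Measurable[Fot E s] fun η => P s η F
  cond : ∀ (s : ℝ≥0) (η : PathOmega E) (t : ℝ≥0), s ≤ t →
    ∀ F : Set (PathOmega E), MeasurableSet F →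
      ∀ G : Set (PathOmega E), MeasurableSet[Fot E t] G →
        ∫⁻ ω in G, P t ω F ∂(P s η) = P s η (F ∩ G)

variable (E)

/-- The `ℙ`-closure of a sub-σ-field `G`: the σ-field generated by `G` and the
`ℙ`-null sets of the ambient σ-field. -/
def pClosure {Ω : Type*} {m0 : MeasurableSpace Ω} (G : MeasurableSpace Ω)
    (μ : @Measure Ω m0) : MeasurableSpace Ω :=
  G ⊔ MeasurableSpace.generateFrom {s | MeasurableSet[m0] s ∧ μ s = 0}


/-- Hypothesis (H): the conditioning property of the canonical class holds with
respect to the canonical filtration `𝓕_t` (and not only `𝓕^o_t`). -/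
def HypH (P : ℝ≥0 → PathOmega E → Measure (PathOmega E)) : Prop :=
  ∀ (s : ℝ≥0) (η : PathOmega E) (t : ℝ≥0), s ≤ t →
    ∀ F : Set (PathOmega E), MeasurableSet F →
      ∀ G : Set (PathOmega E), MeasurableSet[Ft E t] G →
        ∫⁻ ω in G, P t ω F ∂(P s η) = P s η (F ∩ G)

variable {E} in
theorem Fot_le (t : ℝ≥0) : Fot E t ≤ instPathOmegaMS E :=
  iSup₂_le fun r _ =>
    le_iSup (fun r : ℝ≥0 => MeasurableSpace.comap (fun ω : PathOmega E => ω.1 r) inferInstance) r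

theorem Fot_mono {s t : ℝ≥0} (h : s ≤ t) : Fot E s ≤ Fot E t :=
  biSup_mono fun _ hr => le_trans hr h

theorem Fot_le_Ft (t : ℝ≥0) : Fot E t ≤ Ft E t :=
  le_iInf₂ fun _ hu => Fot_mono E (le_of_lt hu)

theorem Ft_le (t : ℝ≥0) : Ft E t ≤ instPathOmegaMS E :=
  (iInf₂_le (t + 1) (lt_add_of_pos_right t one_pos)).trans (Fot_le (t + 1))

theorem pClosure_mono {Ω : Type*} {m0 : MeasurableSpace Ω} {G G' : MeasurableSpace Ω}
    (h : G ≤ G') (μ : @Measure Ω m0) : pClosure G μ ≤ pClosure G' μ :=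
  sup_le_sup_right h _

/-- Every set of the closure of `G` is almost surely equal to a set of `G`. -/
theorem exists_ae_eq_of_measurableSet_pClosure {Ω : Type*} {m0 : MeasurableSpace Ω}
    {G : MeasurableSpace Ω} {μ : @Measure Ω m0} {B : Set Ω}
    (hB : MeasurableSet[pClosure G μ] B) : ∃ C, MeasurableSet[G] C ∧ B =ᵐ[μ] C := by
  have h : pClosure G μ ≤ eventuallyMeasurableSpace G (ae μ) :=
    sup_le le_eventuallyMeasurableSpace <| MeasurableSpace.generateFrom_le fun s hs =>
      ⟨∅, @MeasurableSet.empty _ G, ae_eq_empty.2 hs.2⟩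
  exact h B hB

/-- An ambient measurable set almost surely equal to a set of `G` belongs to the closure of `G`. -/
theorem measurableSet_pClosure_of_ae_eq {Ω : Type*} {m0 : MeasurableSpace Ω}
    {G : MeasurableSpace Ω} (hG : G ≤ m0) {μ : @Measure Ω m0} {B C : Set Ω}
    (hB : MeasurableSet[m0] B) (hC : MeasurableSet[G] C) (h : B =ᵐ[μ] C) :
    MeasurableSet[pClosure G μ] B := by
  have hC' : MeasurableSet[pClosure G μ] C :=
    (le_sup_left : G ≤ pClosure G μ) C hC
  have hN : MeasurableSet[pClosure G μ] (symmDiff B C) :=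
    (le_sup_right : _ ≤ pClosure G μ) _ <| MeasurableSpace.measurableSet_generateFrom
      ⟨hB.symmDiff (hG C hC), measure_symmDiff_eq_zero_iff.2 h⟩
  rw [← symmDiff_symmDiff_cancel_right C B]
  exact @MeasurableSet.symmDiff _ (pClosure G μ) _ _ hN hC'

variable {E} in
/-- Under Hypothesis (H), a set of `𝓕_t` is almost surely equal to a set of `𝓕^o_t`. -/
theorem HypH.exists_ae_eq {P : ℝ≥0 → PathOmega E → Measure (PathOmega E)}
    (hH : HypH E P) (hP : IsPathCanonicalClass P) {s t : ℝ≥0} (η : PathOmega E) (hst : s ≤ t)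
    {B : Set (PathOmega E)} (hB : MeasurableSet[Ft E t] B) :
    ∃ C, MeasurableSet[Fot E t] C ∧ B =ᵐ[P s η] C := by
  have vanish : ∀ D, MeasurableSet[Ft E t] D → ∀ᵐ ω ∂(P s η), ω ∈ D → P t ω Dᶜ = 0 := by
    intro D hD
    have hD' := Ft_le E t D hD
    have h := hH s η t hst Dᶜ hD'.compl D hD
    rw [compl_inter_self, measure_empty,
      setLIntegral_eq_zero_iff hD' ((hP.fos_meas t _ hD'.compl).mono (Fot_le t) le_rfl)] at h
    exact h
  have hB' := Ft_le E t B hB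
  refine ⟨{ω | P t ω Bᶜ = 0}, hP.fos_meas t _ hB'.compl (measurableSet_singleton 0), ?_⟩
  filter_upwards [vanish B hB, vanish Bᶜ (@MeasurableSet.compl _ _ (Ft E t) hB)] with ω h₁ h₂
  refine propext ⟨h₁, fun h => ?_⟩
  by_contra hω
  have := hP.isProb t ω
  have hsum := prob_add_prob_compl (μ := P t ω) hB'
  rw [show P t ω Bᶜ = 0 from h, ← compl_compl B, h₂ hω] at hsum
  simp at hsum

/-- Proposition 2.17: under Hypothesis (H), for `t ≥ s` the
`ℙ^{s,η}`-closures of `𝓕^o_t` and of `𝓕_t` coincide; in particular every set of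
the `ℙ^{s,η}`-closure of `𝓕_t` agrees up to a `ℙ^{s,η}`-null set with a set of
`𝓕^o_t`, and conversely. -/
theorem pClosure_Fot_eq_pClosure_Ft [PolishSpace E] [BorelSpace E]
    (P : ℝ≥0 → PathOmega E → Measure (PathOmega E))
    (hP : IsPathCanonicalClass P) (hH : HypH E P)
    (s : ℝ≥0) (η : PathOmega E) (t : ℝ≥0) (hst : s ≤ t) :
    pClosure (Fot E t) (P s η) = pClosure (Ft E t) (P s η) ∧
      ∀ B : Set (PathOmega E), MeasurableSet[pClosure (Ft E t) (P s η)] B →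
        ∃ Fo : Set (PathOmega E), MeasurableSet[Fot E t] Fo ∧
          ∀ᵐ ω ∂(P s η), ω ∈ B ↔ ω ∈ Fo := by
  have hclosure : Ft E t ≤ pClosure (Fot E t) (P s η) := fun B hB =>
    let ⟨_, hC, hBC⟩ := hH.exists_ae_eq hP η hst hB
    measurableSet_pClosure_of_ae_eq (Fot_le t) (Ft_le E t B hB) hC hBC
  have heq : pClosure (Fot E t) (P s η) = pClosure (Ft E t) (P s η) :=
    le_antisymm (pClosure_mono (Fot_le_Ft E t) _) (sup_le hclosure le_sup_right)
  refine ⟨heq, fun B hB => ?_⟩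
  obtain ⟨C, hC, hBC⟩ := exists_ae_eq_of_measurableSet_pClosure (heq ▸ hB)
  exact ⟨C, hC, hBC.mem_iff⟩
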